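/- (Truthfulness at winning slots in equilibrium.) Let A be an input for the team power game and let B be a 1-strong Nash equilibrium for A. Then for every winning time slot j of B and every team i such that ∑_{i' ≠ i} B i' j > 0 (some other team declares positive availability at j), it holds that B i j = A i j, i.e., team i declares its true availability at slot j. -/

import Mathlib

open Finset

section TPG

variable {T C : Type*} [Fintype T] [Fintype C] [DecidableEq T] [DecidableEq C]

/-- Sum of declared availabilities at a time slot. -/
def colSum (B : T → C → ℕ) (j : C) : ℕ := ∑ i, B i j

/-- Winning time slots: those maximizing the column sum. -/
def winners (B : T → C → ℕ) : Finset C :=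
  Finset.univ.filter fun j => ∀ j', colSum B j' ≤ colSum B j

/-- Relative power of team `i` at slot `j` (0 when the denominator is 0). -/
def power (B : T → C → ℕ) (i : T) (j : C) : ℚ :=
  (B i j : ℚ) / (colSum B j : ℚ)

/-- Pay-off of team `i`: minimum relative power over all winning slots. -/
def payoff (B : T → C → ℕ) (i : T) : ℚ :=
  if h : (winners B).Nonempty then (winners B).inf' h (power B i) else 0

/-- `B` is a strategy profile for input `A`. -/
def IsProfile (A B : T → C → ℕ) : Prop := ∀ i j, B i j ≤ A i j

/-- `D` is an improvement step for coalition `S` with respect to `B` (for input `A`). -/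
def IsImprovement (A B : T → C → ℕ) (S : Finset T) (D : T → C → ℕ) : Prop :=
  IsProfile A D ∧ (∀ i ∉ S, ∀ j, D i j = B i j) ∧ ∀ i ∈ S, payoff B i < payoff D i

/-- `B` is a `t`-strong Nash equilibrium for `A`. -/
def IsStrongNash (t : ℕ) (A B : T → C → ℕ) : Prop :=
  IsProfile A B ∧
    ∀ S : Finset T, S.Nonempty → S.card ≤ t → ∀ D, ¬ IsImprovement A B S D

end TPG

section Payoff

variable {T C : Type*} [Fintype T] [Fintype C]

lemma payoff_le_power (B : T → C → ℕ) (i : T) {j : C} (hj : j ∈ winners B) :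
    payoff B i ≤ power B i j := by
  rw [payoff, dif_pos ⟨j, hj⟩]
  exact Finset.inf'_le _ hj

lemma payoff_eq_power_of_winners_eq_singleton {B : T → C → ℕ} {j : C}
    (h : winners B = {j}) (i : T) : payoff B i = power B i j := by
  simp [payoff, h]

end Payoff

section RaiseEntry

variable {T C : Type*} [Fintype T] [DecidableEq T] [DecidableEq C]

/-- The matrix `B` with one unit added at team `i` and slot `j`. -/
def raiseEntry (B : T → C → ℕ) (i : T) (j : C) : T → C → ℕ :=
  fun i' j' => B i' j' + if i' = i ∧ j' = j then 1 else 0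

lemma colSum_raiseEntry (B : T → C → ℕ) (i : T) (j j' : C) :
    colSum (raiseEntry B i j) j' = colSum B j' + if j' = j then 1 else 0 := by
  by_cases h : j' = j <;> simp [colSum, raiseEntry, Finset.sum_add_distrib, h]

variable [Fintype C]

lemma winners_raiseEntry (B : T → C → ℕ) (i : T) {j : C} (hj : j ∈ winners B) :
    winners (raiseEntry B i j) = {j} := by
  have hmax : ∀ j', colSum B j' ≤ colSum B j := by simpa [winners] using hj
  ext k
  simp only [winners, Finset.mem_filter_univ, colSum_raiseEntry, Finset.mem_singleton]
  constructor
  · intro h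
    by_contra hk
    have hle := h j
    have hk' := hmax k
    simp only [if_true, if_neg hk] at hle
    omega
  · rintro rfl j'
    have hj' := hmax j'
    rw [if_pos rfl]
    split_ifs <;> omega

lemma payoff_lt_payoff_raiseEntry (B : T → C → ℕ) (i : T) {j : C} (hj : j ∈ winners B)
    (hlt : B i j < colSum B j) : payoff B i < payoff (raiseEntry B i j) i := by
  refine (payoff_le_power B i hj).trans_lt ?_
  rw [payoff_eq_power_of_winners_eq_singleton (winners_raiseEntry B i hj), power, power,
    colSum_raiseEntry]
  have hpos : (0 : ℚ) < colSum B j := by exact_mod_cast (Nat.zero_le _).trans_lt hlt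
  have hlt' : (B i j : ℚ) < colSum B j := by exact_mod_cast hlt
  simp only [raiseEntry, and_self, if_true, Nat.cast_add, Nat.cast_one]
  rw [div_lt_div_iff₀ hpos (by positivity)]
  linarith

end RaiseEntry

/-- Truthfulness at winning slots in equilibrium: in a 1-strong Nash equilibrium `B`,
at every winning slot `j`, every team `i` for which some other team declares positive
availability at `j` declares its true availability at `j`. -/
theorem truthful_at_winning_slot {n m : ℕ} (A B : Fin n → Fin m → ℕ)
    (hNE : IsStrongNash 1 A B) (j : Fin m) (hj : j ∈ winners B)
    (i : Fin n) (hpos : 0 < ∑ i' ∈ Finset.univ.erase i, B i' j) :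
    B i j = A i j := by
  by_contra hne
  have hlt : B i j < A i j := lt_of_le_of_ne (hNE.1 i j) hne
  have hsum : B i j < colSum B j := by
    rw [colSum, ← Finset.add_sum_erase _ _ (Finset.mem_univ i)]
    omega
  refine hNE.2 {i} (Finset.singleton_nonempty i) (Finset.card_singleton i).le
    (raiseEntry B i j) ⟨fun i' j' => ?_, fun i' hi' j' => ?_, fun i' hi' => ?_⟩
  · have hB := hNE.1 i' j'
    unfold raiseEntry
    split_ifs with h
    · obtain ⟨rfl, rfl⟩ := h
      exact hlt
    · exact hB
  · simp [raiseEntry, Finset.notMem_singleton.mp hi']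
  · obtain rfl := Finset.mem_singleton.mp hi'
    exact payoff_lt_payoff_raiseEntry B i' hj hsum
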